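/- Let W0 ∈ ℝ^{n×K} and H0 ∈ ℝ^{K×p} with W0 row-stochastic, W0 and W0_train of rank K, H0 nonnegative, and H0 and H0_T having linearly independent rows. Assume condition (A1): the nonnegative orthant {x ∈ ℝ^K : x ≥ 0 entrywise} is the only K-simplicial cone belonging to the union of the two sets {C : Cone(W0_train) ⊆ C ⊆ D(H0)} and {C : Cone(W0) ⊆ C ⊆ D(H0_T)}. Assume condition (A2): the convex hull of the rows of the matrix W0_train H0 has internal radius μ > 0 (in dimension K−1) with some center z0 ∈ ℝ^p. Then for every row-stochastic W ∈ ℝ^{n×K} of rank K and every nonnegative H ∈ ℝ^{K×p} with linearly independent rows satisfying T(W H) = T(W0 H0), there exists a permutation σ of {1,…,K} such that W_{ik} = (W0)_{i σ(k)} for all i,k and H_{kj} = (H0)_{σ(k) j} for all k,j (i.e., equality up to permutation only, with no scaling). -/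

import Mathlib

open Matrix

noncomputable section

/-- Squared Frobenius norm `‖A‖_F²`. -/
def frobSq {m p : ℕ} (A : Matrix (Fin m) (Fin p) ℝ) : ℝ := ∑ i, ∑ j, (A i j) ^ 2

/-- Frobenius norm `‖A‖_F`. -/
def frobNorm {m p : ℕ} (A : Matrix (Fin m) (Fin p) ℝ) : ℝ := Real.sqrt (frobSq A)

/-- Euclidean norm `‖v‖₂` of a vector. -/
def eNorm {m : ℕ} (v : Fin m → ℝ) : ℝ := Real.sqrt (∑ i, (v i) ^ 2)

/-- Entrywise nonnegative matrix. -/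
def Nonneg {m K : ℕ} (A : Matrix (Fin m) (Fin K) ℝ) : Prop := ∀ i k, 0 ≤ A i k

/-- Row-stochastic matrix: nonnegative with unit row sums. -/
def RowStochastic {m K : ℕ} (W : Matrix (Fin m) (Fin K) ℝ) : Prop :=
  Nonneg W ∧ ∀ i, ∑ k, W i k = 1

/-- The mask operator `T` zeroing the bottom-right `N × F` block. -/
def maskT (n N p F : ℕ) (M : Matrix (Fin n) (Fin p) ℝ) : Matrix (Fin n) (Fin p) ℝ :=
  Matrix.of fun i j => if (i : ℕ) < n - N ∨ (j : ℕ) < p - F then M i j else 0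

/-- Cone generated by the rows of `W`. -/
def coneRows {m K : ℕ} (W : Matrix (Fin m) (Fin K) ℝ) : Set (Fin K → ℝ) :=
  {x | ∃ c : Fin m → ℝ, (∀ i, 0 ≤ c i) ∧ x = ∑ i, c i • W i}

/-- Dual cone of the columns of `H`: `{x | xᵀ H ≥ 0}`. -/
def dualConeCols {K q : ℕ} (H : Matrix (Fin K) (Fin q) ℝ) : Set (Fin K → ℝ) :=
  {x | ∀ j, 0 ≤ ∑ k, x k * H k j}

/-- A `K`-simplicial cone: the cone generated by `K` linearly independent vectors of `ℝ^K`. -/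
def IsSimplicialCone {K : ℕ} (C : Set (Fin K → ℝ)) : Prop :=
  ∃ B : Matrix (Fin K) (Fin K) ℝ, LinearIndependent ℝ (fun k => B k) ∧ C = coneRows B

/-- The nonnegative orthant of `ℝ^K`. -/
def nonnegOrthant (K : ℕ) : Set (Fin K → ℝ) := {x | ∀ k, 0 ≤ x k}

/-- `(W, H) ≡ (W0, H0)`: equality up to permutation and positive scaling of the
columns of `W` (resp. rows of `H`). -/
def EquivScalePerm {n K p : ℕ} (W W0 : Matrix (Fin n) (Fin K) ℝ)
    (H H0 : Matrix (Fin K) (Fin p) ℝ) : Prop :=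
  ∃ σ : Equiv.Perm (Fin K), ∃ d : Fin K → ℝ, (∀ k, 0 < d k) ∧
    (∀ i k, W i k = d k * W0 i (σ k)) ∧ (∀ k j, H k j = (d k)⁻¹ * H0 (σ k) j)

/-- The convex hull of the rows of `A` has internal radius `μ` (in dimension `K − 1`)
with center `z0`. -/
def HasInternalRadius {m p : ℕ} (A : Matrix (Fin m) (Fin p) ℝ) (K : ℕ) (μ : ℝ)
    (z0 : Fin p → ℝ) : Prop :=
  ∃ U : Matrix (Fin p) (Fin (K - 1)) ℝ, Uᵀ * U = 1 ∧
    ∀ y : Fin (K - 1) → ℝ, eNorm y ≤ μ →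
      z0 + U.mulVec y ∈ convexHull ℝ (Set.range fun i => A i)

theorem Matrix.exists_left_inverse_of_rank_eq_card {m K : ℕ} {A : Matrix (Fin m) (Fin K) ℝ}
    (hA : A.rank = K) : ∃ L : Matrix (Fin K) (Fin m) ℝ, L * A = 1 := by
  have hrank : (Aᵀ * A).rank = K := by rw [Matrix.rank_transpose_mul_self, hA]
  have hsurj : Function.Surjective (Aᵀ * A).mulVec := by
    have htop : LinearMap.range (Aᵀ * A).mulVecLin = ⊤ :=
      Submodule.eq_top_of_finrank_eq (by simpa [Matrix.rank] using hrank)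
    exact LinearMap.range_eq_top.mp htop
  obtain ⟨B, hB⟩ := Matrix.mulVec_surjective_iff_exists_right_inverse.mp hsurj
  exact ⟨B * Aᵀ, by rw [Matrix.mul_assoc, mul_eq_one_comm.mp hB]⟩

theorem Matrix.exists_right_inverse_of_linearIndependent_rows {K q : ℕ}
    {H : Matrix (Fin K) (Fin q) ℝ} (hH : LinearIndependent ℝ (fun k => H k)) :
    ∃ R : Matrix (Fin q) (Fin K) ℝ, H * R = 1 := by
  have hrank : Hᵀ.rank = K := by
    rw [Matrix.rank_transpose, LinearIndependent.rank_matrix hH, Fintype.card_fin]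
  obtain ⟨L, hL⟩ := Matrix.exists_left_inverse_of_rank_eq_card hrank
  exact ⟨Lᵀ, by rw [← Matrix.transpose_transpose H, ← Matrix.transpose_mul, hL,
    Matrix.transpose_one]⟩

/-- Two factorizations of full rank which agree on the rows selected by `r` and on the columns
selected by `s` differ by an invertible change of basis. -/
theorem exists_change_of_basis {m n K p q : ℕ} {r : Fin m → Fin n} {s : Fin q → Fin p}
    {W W0 : Matrix (Fin n) (Fin K) ℝ} {H H0 : Matrix (Fin K) (Fin p) ℝ}
    (hW0 : (W0.submatrix r id).rank = K)
    (hH0 : LinearIndependent ℝ (fun k => H0 k))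
    (hH0s : LinearIndependent ℝ (fun k => (H0.submatrix id s) k))
    (hrow : W.submatrix r id * H = W0.submatrix r id * H0)
    (hcol : W * H.submatrix id s = W0 * H0.submatrix id s) :
    ∃ Q R : Matrix (Fin K) (Fin K) ℝ, R * Q = 1 ∧ H = Q * H0 ∧ W0 = W * Q := by
  obtain ⟨L, hL⟩ := Matrix.exists_left_inverse_of_rank_eq_card hW0
  obtain ⟨S0, hS0⟩ := Matrix.exists_right_inverse_of_linearIndependent_rows hH0
  obtain ⟨S1, hS1⟩ := Matrix.exists_right_inverse_of_linearIndependent_rows hH0s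
  have hRH : (L * W.submatrix r id) * H = H0 := by
    rw [Matrix.mul_assoc, hrow, ← Matrix.mul_assoc, hL, Matrix.one_mul]
  have hRQ : (L * W.submatrix r id) * (H * S0) = 1 := by
    rw [← Matrix.mul_assoc, hRH, hS0]
  have hQ : H = (H * S0) * H0 := by
    rw [← hRH, ← Matrix.mul_assoc, mul_eq_one_comm.mp hRQ, Matrix.one_mul]
  refine ⟨H * S0, L * W.submatrix r id, hRQ, hQ, ?_⟩
  have hQs : H.submatrix id s = (H * S0) * H0.submatrix id s := by
    conv_lhs => rw [hQ]
    rfl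
  calc W0 = W0 * (H0.submatrix id s * S1) := by rw [hS1, Matrix.mul_one]
    _ = W * (H * S0) * (H0.submatrix id s * S1) := by
      rw [← Matrix.mul_assoc, ← hcol, hQs]
      simp only [Matrix.mul_assoc]
    _ = W * (H * S0) := by rw [hS1, Matrix.mul_one]

theorem mem_coneRows_iff {m K : ℕ} {W : Matrix (Fin m) (Fin K) ℝ} {x : Fin K → ℝ} :
    x ∈ coneRows W ↔ ∃ c : Fin m → ℝ, (∀ i, 0 ≤ c i) ∧ x = c ᵥ* W := by
  simp only [coneRows, Set.mem_ofPred_eq, Matrix.vecMul_eq_sum]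

theorem row_mem_coneRows {m K : ℕ} (W : Matrix (Fin m) (Fin K) ℝ) (i : Fin m) :
    W i ∈ coneRows W :=
  mem_coneRows_iff.mpr ⟨Pi.single i 1, fun j => by
    by_cases h : j = i
    · subst h; simp
    · simp [h], by rw [Matrix.single_one_vecMul]; rfl⟩

theorem coneRows_mul_subset {m K : ℕ} {W : Matrix (Fin m) (Fin K) ℝ} (hW : Nonneg W)
    (Q : Matrix (Fin K) (Fin K) ℝ) : coneRows (W * Q) ⊆ coneRows Q := by
  intro x hx
  obtain ⟨c, hc, rfl⟩ := mem_coneRows_iff.mp hx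
  exact mem_coneRows_iff.mpr ⟨c ᵥ* W,
    fun k => dotProduct_nonneg_of_nonneg hc fun i => hW i k,
    (Matrix.vecMul_vecMul c W Q).symm⟩

theorem coneRows_subset_dualConeCols {K p : ℕ} {Q : Matrix (Fin K) (Fin K) ℝ}
    {H0 : Matrix (Fin K) (Fin p) ℝ} (h : Nonneg (Q * H0)) :
    coneRows Q ⊆ dualConeCols H0 := by
  intro x hx j
  obtain ⟨c, hc, rfl⟩ := mem_coneRows_iff.mp hx
  change 0 ≤ ((c ᵥ* Q) ᵥ* H0) j
  rw [Matrix.vecMul_vecMul]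
  exact dotProduct_nonneg_of_nonneg hc fun i => h i j

/-- A square row-stochastic matrix with a row-stochastic left inverse is a permutation matrix. -/
theorem exists_perm_of_rowStochastic_mul_eq_one {K : ℕ} {Q R : Matrix (Fin K) (Fin K) ℝ}
    (hQ : RowStochastic Q) (hR : RowStochastic R) (hRQ : R * Q = 1) :
    ∃ σ : Equiv.Perm (Fin K), ∀ k, Q (σ k) = Pi.single k 1 := by
  have hpos : ∀ k, ∃ l, 0 < R k l := by
    intro k
    by_contra! h
    have := Finset.sum_nonpos fun l (_ : l ∈ Finset.univ) => h l
    rw [hR.2 k] at this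
    linarith
  choose f hf using hpos
  have hzero : ∀ k j, j ≠ k → Q (f k) j = 0 := by
    intro k j hjk
    have hsum : ∑ l, R k l * Q l j = 0 := by
      rw [← Matrix.mul_apply, hRQ, Matrix.one_apply_ne hjk.symm]
    have := (Finset.sum_eq_zero_iff_of_nonneg
      fun l _ => mul_nonneg (hR.1 k l) (hQ.1 l j)).mp hsum (f k) (Finset.mem_univ _)
    exact (mul_eq_zero.mp this).resolve_left (hf k).ne'
  have hone : ∀ k, Q (f k) k = 1 := fun k => by
    rw [← hQ.2 (f k), Finset.sum_eq_single k (fun j _ hj => hzero k j hj) (by simp)]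
  have hinj : Function.Injective f := by
    intro a b hab
    by_contra hne
    have := hone a
    rw [hab, hzero b a hne] at this
    exact zero_ne_one this
  refine ⟨Equiv.ofBijective f (Finite.injective_iff_bijective.mp hinj), fun k => ?_⟩
  ext j
  rw [Equiv.ofBijective_apply]
  by_cases h : j = k
  · subst h; simp [hone]
  · simp [h, hzero k j h]

theorem nonneg_of_coneRows_eq_nonnegOrthant {K : ℕ} {Q R : Matrix (Fin K) (Fin K) ℝ}
    (hRQ : R * Q = 1) (h : coneRows Q = nonnegOrthant K) : Nonneg Q ∧ Nonneg R := by
  refine ⟨fun i k => (h ▸ row_mem_coneRows Q i : Q i ∈ nonnegOrthant K) k, fun k => ?_⟩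
  have hmem : (Pi.single k 1 : Fin K → ℝ) ∈ coneRows Q := by
    rw [h]
    intro j
    by_cases hj : j = k
    · subst hj; simp
    · simp [hj]
  obtain ⟨c, hc, hcQ⟩ := mem_coneRows_iff.mp hmem
  have : R k = c := by
    have h1 := congrArg (· ᵥ* R) hcQ
    simp only [Matrix.vecMul_vecMul, mul_eq_one_comm.mp hRQ, Matrix.vecMul_one,
      Matrix.single_one_vecMul] at h1
    exact h1
  rw [this]
  exact hc

theorem mulVec_one_eq_one_iff {m K : ℕ} {W : Matrix (Fin m) (Fin K) ℝ} :
    W *ᵥ 1 = 1 ↔ ∀ i, ∑ k, W i k = 1 := by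
  simp [funext_iff, Matrix.mulVec, dotProduct]

/-- under (A1) and (A2) and row-stochasticity of `W0` and `W`,
partial observations determine the factorization up to permutation only (no scaling). -/
theorem stmt2 {n N p F K : ℕ} (hN : 1 ≤ N) (hn : N < n) (hF : 1 ≤ F) (hp : F < p)
    (W0 : Matrix (Fin n) (Fin K) ℝ) (H0 : Matrix (Fin K) (Fin p) ℝ)
    (hW0 : RowStochastic W0) (hH0 : Nonneg H0)
    (hW0rank : W0.rank = K)
    (hW0trainrank : (W0.submatrix (Fin.castLE (Nat.sub_le n N)) id).rank = K)
    (hH0li : LinearIndependent ℝ (fun k => H0 k))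
    (hH0Tli : LinearIndependent ℝ (fun k => (H0.submatrix id (Fin.castLE (Nat.sub_le p F))) k))
    (hA1 : ∀ C : Set (Fin K → ℝ), IsSimplicialCone C →
        ((coneRows (W0.submatrix (Fin.castLE (Nat.sub_le n N)) id) ⊆ C ∧
            C ⊆ dualConeCols H0) ∨
          (coneRows W0 ⊆ C ∧
            C ⊆ dualConeCols (H0.submatrix id (Fin.castLE (Nat.sub_le p F))))) →
        C = nonnegOrthant K)
    (μ : ℝ) (hμ : 0 < μ) (z0 : Fin p → ℝ)
    (hA2 : HasInternalRadius ((W0.submatrix (Fin.castLE (Nat.sub_le n N)) id) * H0) K μ z0) :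
    ∀ (W : Matrix (Fin n) (Fin K) ℝ) (H : Matrix (Fin K) (Fin p) ℝ),
      RowStochastic W → Nonneg H → W.rank = K → LinearIndependent ℝ (fun k => H k) →
      maskT n N p F (W * H) = maskT n N p F (W0 * H0) →
      ∃ σ : Equiv.Perm (Fin K),
        (∀ i k, W i k = W0 i (σ k)) ∧ (∀ k j, H k j = H0 (σ k) j) := by
  intro W H hW hH _ _ hT
  have hrow : W.submatrix (Fin.castLE (Nat.sub_le n N)) id * H =
      W0.submatrix (Fin.castLE (Nat.sub_le n N)) id * H0 := by
    ext i j
    simpa [maskT, Matrix.mul_apply] using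
      congrFun (congrFun hT (Fin.castLE (Nat.sub_le n N) i)) j
  have hcol : W * H.submatrix id (Fin.castLE (Nat.sub_le p F)) =
      W0 * H0.submatrix id (Fin.castLE (Nat.sub_le p F)) := by
    ext i j
    simpa [maskT, Matrix.mul_apply] using
      congrFun (congrFun hT i) (Fin.castLE (Nat.sub_le p F) j)
  obtain ⟨Q, R, hRQ, rfl, rfl⟩ :=
    exists_change_of_basis hW0trainrank hH0li hH0Tli hrow hcol
  have hcone : coneRows Q = nonnegOrthant K :=
    hA1 _ ⟨Q, Matrix.linearIndependent_rows_iff_isUnit.mpr (IsUnit.of_mul_eq_one_right R hRQ), rfl⟩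
      (Or.inl ⟨coneRows_mul_subset (W := W.submatrix (Fin.castLE (Nat.sub_le n N)) id)
          (fun i k => hW.1 _ k) Q,
        coneRows_subset_dualConeCols hH⟩)
  obtain ⟨hQnn, hRnn⟩ := nonneg_of_coneRows_eq_nonnegOrthant hRQ hcone
  have hR1 : R *ᵥ 1 = 1 := by
    obtain ⟨L, hL⟩ := Matrix.exists_left_inverse_of_rank_eq_card hW0rank
    have h1 : (W * Q) *ᵥ (R *ᵥ 1) = (W * Q) *ᵥ 1 := by
      rw [Matrix.mulVec_mulVec, Matrix.mul_assoc, mul_eq_one_comm.mp hRQ, Matrix.mul_one,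
        mulVec_one_eq_one_iff.mpr hW.2, mulVec_one_eq_one_iff.mpr hW0.2]
    simpa only [Matrix.mulVec_mulVec, ← Matrix.mul_assoc, hL, Matrix.one_mulVec, Matrix.one_mul]
      using congrArg (L *ᵥ ·) h1
  have hQ1 : Q *ᵥ 1 = 1 := by
    conv_lhs => rw [← hR1, Matrix.mulVec_mulVec, mul_eq_one_comm.mp hRQ, Matrix.one_mulVec]
  obtain ⟨σ, hσ⟩ := exists_perm_of_rowStochastic_mul_eq_one
    ⟨hQnn, mulVec_one_eq_one_iff.mp hQ1⟩ ⟨hRnn, mulVec_one_eq_one_iff.mp hR1⟩ hRQ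
  refine ⟨σ.symm, fun i k => ?_, fun k j => ?_⟩
  · rw [Matrix.mul_apply, ← Equiv.sum_comp σ]
    simp [hσ, Pi.single_apply]
  · obtain ⟨l, rfl⟩ := σ.surjective k
    simp [Matrix.mul_apply, hσ, Pi.single_apply]
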